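/- arXiv:1404.7438 — 4 statements merged into one kernel-verified Lean document; each statement's English description precedes it below -/
import Mathlib

section
/- Let (Ω, 𝓕, ℙ) be a probability space, let α > 0, and let X_1, …, X_n be real random variables such that E[exp(α|X_j|)] < ∞ for each j = 1, …, n. Then for every p ∈ [1, ∞) the vector space {P(X_1, …, X_n) : P a polynomial of n real variables} is dense in L^p(Ω, σ(X_1, …, X_n), ℙ): for every real random variable Y that is measurable with respect to σ(X_1, …, X_n) and satisfies E[|Y|^p] < ∞, and for every ε > 0, there exists a polynomial P of n real variables with E[|Y − P(X_1, …, X_n)|^p] < ε^p. -/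
open MeasureTheory

open Filter Topology

open scoped ENNReal

section PolynomialDensity

/-- Dominated convergence in `L^p`. -/
lemma tendsto_eLpNorm_sub_of_dominated {β : Type*} [MeasurableSpace β] {μ : Measure β}
    {p : ℝ≥0∞} (hp0 : p ≠ 0) (hpt : p ≠ ∞) {F : ℕ → β → ℝ} {f B : β → ℝ}
    (hF : ∀ k, AEStronglyMeasurable (F k) μ) (hf : AEStronglyMeasurable f μ)
    (hB : MemLp B p μ) (hFB : ∀ k x, |F k x| ≤ B x)
    (hlim : ∀ x, Tendsto (fun k => F k x) atTop (𝓝 (f x))) :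
    Tendsto (fun k => eLpNorm (f - F k) p μ) atTop (𝓝 0) := by
  have hp : 0 < p.toReal := ENNReal.toReal_pos hp0 hpt
  have hfB : ∀ x, |f x| ≤ B x := fun x =>
    le_of_tendsto (hlim x).abs (Eventually.of_forall fun k => hFB k x)
  simp_rw [eLpNorm_eq_lintegral_rpow_enorm_toReal hp0 hpt]
  have key : Tendsto (fun k => ∫⁻ x, ‖(f - F k) x‖ₑ ^ p.toReal ∂μ) atTop (𝓝 0) := by
    rw [← lintegral_zero (μ := μ)]
    refine tendsto_lintegral_of_dominated_convergence'
      (fun x => ‖((2 : ℝ) • B) x‖ₑ ^ p.toReal)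
      (fun k => (hf.sub (hF k)).enorm.pow_const _) (fun k => Eventually.of_forall fun x => ?_)
      ?_ (Eventually.of_forall fun x => ?_)
    · refine ENNReal.rpow_le_rpow (enorm_le_iff_norm_le.2 ?_) hp.le
      have hB0 : 0 ≤ B x := (abs_nonneg _).trans (hfB x)
      simp only [Pi.sub_apply, Pi.smul_apply, smul_eq_mul, Real.norm_eq_abs, abs_mul,
        abs_of_nonneg hB0]
      calc |f x - F k x| ≤ |f x| + |F k x| := abs_sub _ _
        _ ≤ |(2 : ℝ)| * B x := by
          rw [abs_two]; linarith [hfB x, hFB k x]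
    · exact (lintegral_rpow_enorm_lt_top_of_eLpNorm_lt_top hp0 hpt
        (hB.const_smul (2 : ℝ)).eLpNorm_lt_top).ne
    · have h1 : Tendsto (fun k => f x - F k x) atTop (𝓝 0) := by
        simpa using (hlim x).const_sub (f x)
      have h2 := (ENNReal.continuous_rpow_const (y := p.toReal)).tendsto _ |>.comp h1.enorm
      simpa [Function.comp_def, ENNReal.zero_rpow_of_pos hp] using h2
  have := (ENNReal.continuous_rpow_const (y := 1 / p.toReal)).tendsto _ |>.comp key
  simpa [Function.comp_def, ENNReal.zero_rpow_of_pos (inv_pos.2 hp)] using this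

variable {ι : Type*}

/-- `f` lies in the closure of the polynomial functions for the `L^p(μ)` seminorm. -/
def IsPolynomialLimit (μ : Measure (ι → ℝ)) (p : ℝ≥0∞) (f : (ι → ℝ) → ℝ) : Prop :=
  ∀ ε : ℝ≥0∞, ε ≠ 0 → ∃ P : MvPolynomial ι ℝ,
    eLpNorm (fun x => f x - MvPolynomial.eval x P) p μ ≤ ε

lemma isPolynomialLimit_eval (μ : Measure (ι → ℝ)) (p : ℝ≥0∞) (P : MvPolynomial ι ℝ) :
    IsPolynomialLimit μ p (fun x => MvPolynomial.eval x P) :=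
  fun ε _ => ⟨P, by simp⟩

lemma exists_mvPolynomial_eval_eq_sin_partialSum (s : ℝ) (j : ι) (N : ℕ) :
    ∃ T : MvPolynomial ι ℝ, ∀ x, MvPolynomial.eval x T =
      ∑ k ∈ Finset.range N, (-1) ^ k * (s * x j) ^ (2 * k + 1) / ((2 * k + 1).factorial : ℝ) := by
  refine ⟨∑ k ∈ Finset.range N, MvPolynomial.C ((-1) ^ k / ((2 * k + 1).factorial : ℝ)) *
    (MvPolynomial.C s * MvPolynomial.X j) ^ (2 * k + 1), fun x => ?_⟩
  simp only [map_sum, map_mul, map_pow, MvPolynomial.eval_C, MvPolynomial.eval_X]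
  exact Finset.sum_congr rfl fun k _ => by ring

lemma abs_sin_partialSum_le_exp_abs (y : ℝ) (N : ℕ) :
    |∑ k ∈ Finset.range N, (-1) ^ k * y ^ (2 * k + 1) / ((2 * k + 1).factorial : ℝ)| ≤
      Real.exp |y| := by
  calc _ ≤ ∑ k ∈ Finset.range N, |y| ^ (2 * k + 1) / ((2 * k + 1).factorial : ℝ) := by
        refine (Finset.abs_sum_le_sum_abs _ _).trans_eq (Finset.sum_congr rfl fun k _ => ?_)
        simp [abs_div, abs_mul, abs_pow]
    _ ≤ Real.sinh |y| :=
        sum_le_hasSum _ (fun k _ => by positivity) (Real.hasSum_sinh |y|)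
    _ ≤ Real.exp |y| := by
        rw [Real.sinh_eq]
        linarith [Real.exp_pos |y|, Real.exp_pos (-|y|)]

lemma separatesPoints_of_sin_mem {A : Subalgebra ℝ C(ι → ℝ, ℝ)} {s₀ : ℝ} (hs₀ : 0 < s₀)
    (hA : ∀ s, 0 < s → s ≤ s₀ → ∀ j,
      (⟨fun x => Real.sin (s * x j), by fun_prop⟩ : C(ι → ℝ, ℝ)) ∈ A) :
    A.SeparatesPoints := by
  intro x y hxy
  obtain ⟨j, hj⟩ := Function.ne_iff.1 hxy
  set M := |x j| + |y j| + 1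
  have hMpos : 0 < M := by positivity
  set s := min s₀ (1 / M)
  have hs : 0 < s := lt_min hs₀ (by positivity)
  have hsM : s * M ≤ 1 := by
    calc s * M ≤ 1 / M * M := by gcongr; exact min_le_right _ _
      _ = 1 := by field_simp
  have hmem : ∀ t, |t| ≤ M → s * t ∈ Set.Icc (-(Real.pi / 2)) (Real.pi / 2) := by
    intro t ht
    have : |s * t| ≤ 1 := by
      rw [abs_mul, abs_of_pos hs]
      exact (mul_le_mul_of_nonneg_left ht hs.le).trans hsM
    have hpi := Real.pi_gt_three
    exact ⟨by linarith [(abs_le.1 this).1], by linarith [(abs_le.1 this).2]⟩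
  refine ⟨_, ⟨_, hA s hs (min_le_left _ _) j, rfl⟩, fun h => hj ?_⟩
  have := Real.injOn_sin (hmem (x j) (by linarith [abs_nonneg (y j)]))
    (hmem (y j) (by linarith [abs_nonneg (x j)])) h
  exact mul_left_cancel₀ hs.ne' this

/-- Truncated Stone–Weierstrass: on a compact set, a bounded continuous function is a uniform
limit of elements of a separating algebra of bounded functions, with a global bound on the
approximants. -/
lemma exists_mem_subalgebra_near_of_isCompact_of_bounded {β : Type*} [TopologicalSpace β]
    {A : Subalgebra ℝ C(β, ℝ)} (hA : A.SeparatesPoints) (hbdd : ∀ a ∈ A, ∃ C, ∀ x, |a x| ≤ C)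
    (f : C(β, ℝ)) {M : ℝ} (hM : ∀ x, |f x| ≤ M) (hM0 : 0 ≤ M) {K : Set β} (hK : IsCompact K)
    {δ : ℝ} (hδ : 0 < δ) :
    ∃ h ∈ A, (∀ x ∈ K, |h x - f x| ≤ 2 * δ) ∧ ∀ x, |h x| ≤ M + δ := by
  obtain ⟨g, hgA, hg⟩ :=
    ContinuousMap.exists_mem_subalgebra_near_continuous_of_isCompact_of_separatesPoints hA f hK hδ
  obtain ⟨C, hC⟩ := hbdd g hgA
  let c : ℝ → ℝ := fun t => max (-M) (min t M)
  have hc : Continuous c := by fun_prop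
  obtain ⟨r, hr⟩ := exists_polynomial_near_of_continuousOn (-C) C c hc.continuousOn δ hδ
  have hrg : ∀ x, |r.eval (g x) - c (g x)| < δ := fun x => hr _ (abs_le.1 (hC x))
  have heval : ∀ x, (Polynomial.aeval g r) x = r.eval (g x) := fun x => by
    rw [Polynomial.aeval_continuousMap_apply]
  refine ⟨Polynomial.aeval g r, ?_, fun x hx => ?_, fun x => ?_⟩
  · exact Algebra.adjoin_singleton_le hgA (Polynomial.aeval_mem_adjoin_singleton ℝ g)
  · rw [heval]
    have h1 : |c (g x) - f x| ≤ |g x - f x| := by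
      have hfx : c (f x) = f x := by
        simp [c, (abs_le.1 (hM x)).1, (abs_le.1 (hM x)).2]
      nth_rewrite 1 [← hfx]
      refine (abs_max_sub_max_le_max _ _ _ _).trans ?_
      refine max_le (by simp) ((abs_min_sub_min_le_max _ _ _ _).trans ?_)
      simp
    have h2 : |g x - f x| < δ := hg x hx
    calc |r.eval (g x) - f x| ≤ |r.eval (g x) - c (g x)| + |c (g x) - f x| := abs_sub_le _ _ _
      _ ≤ 2 * δ := by linarith [hrg x]
  · rw [heval]
    have h1 : |c (g x)| ≤ M := abs_le.2
      ⟨le_max_left _ _, max_le (by linarith) (min_le_right _ _)⟩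
    have := abs_sub_abs_le_abs_sub (r.eval (g x)) (c (g x))
    linarith [hrg x]

lemma holderTriple_two_mul (q : ℝ≥0∞) : ENNReal.HolderTriple (2 * q) (2 * q) q where
  inv_add_inv_eq_inv := by
    rw [← two_mul, ENNReal.mul_inv (by simp) (by simp), ← mul_assoc,
      ENNReal.mul_inv_cancel (by simp) (by simp), one_mul]

variable [Fintype ι] {μ : Measure (ι → ℝ)} {p : ℝ≥0∞}

lemma aestronglyMeasurable_eval_mvPolynomial (P : MvPolynomial ι ℝ) :
    AEStronglyMeasurable (fun x : ι → ℝ => MvPolynomial.eval x P) μ :=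
  (MvPolynomial.continuous_eval P).aestronglyMeasurable

lemma IsPolynomialLimit.add (hp : 1 ≤ p) {f g : (ι → ℝ) → ℝ}
    (hfm : AEStronglyMeasurable f μ) (hgm : AEStronglyMeasurable g μ)
    (hf : IsPolynomialLimit μ p f) (hg : IsPolynomialLimit μ p g) :
    IsPolynomialLimit μ p (fun x => f x + g x) := by
  intro ε hε
  obtain ⟨P, hP⟩ := hf (ε / 2) (ENNReal.half_pos hε).ne'
  obtain ⟨Q, hQ⟩ := hg (ε / 2) (ENNReal.half_pos hε).ne'
  refine ⟨P + Q, ?_⟩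
  have := eLpNorm_add_le (hfm.sub (aestronglyMeasurable_eval_mvPolynomial P))
    (hgm.sub (aestronglyMeasurable_eval_mvPolynomial Q)) hp
  calc _ = _ := by
        congr 1
        ext x
        simp only [Pi.add_apply, Pi.sub_apply, map_add]
        ring
    _ ≤ _ := this
    _ ≤ ε / 2 + ε / 2 := add_le_add hP hQ
    _ = ε := ENNReal.add_halves ε

lemma IsPolynomialLimit.of_forall_near (hp : 1 ≤ p) {f : (ι → ℝ) → ℝ}
    (hfm : AEStronglyMeasurable f μ)
    (h : ∀ ε : ℝ≥0∞, ε ≠ 0 → ∃ g, AEStronglyMeasurable g μ ∧ IsPolynomialLimit μ p g ∧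
      eLpNorm (f - g) p μ ≤ ε) :
    IsPolynomialLimit μ p f := by
  intro ε hε
  obtain ⟨g, hgm, hg, hfg⟩ := h (ε / 2) (ENNReal.half_pos hε).ne'
  obtain ⟨P, hP⟩ := hg (ε / 2) (ENNReal.half_pos hε).ne'
  refine ⟨P, ?_⟩
  have := eLpNorm_add_le (hfm.sub hgm)
    (hgm.sub (aestronglyMeasurable_eval_mvPolynomial P)) hp
  calc _ = _ := by
        congr 1
        ext x
        simp only [Pi.add_apply, Pi.sub_apply]
        ring
    _ ≤ _ := this
    _ ≤ ε / 2 + ε / 2 := add_le_add hfg hP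
    _ = ε := ENNReal.add_halves ε

lemma IsPolynomialLimit.of_dominated (hp : 1 ≤ p) (hpt : p ≠ ∞) {F : ℕ → (ι → ℝ) → ℝ}
    {f B : (ι → ℝ) → ℝ} (hF : ∀ k, AEStronglyMeasurable (F k) μ)
    (hf : AEStronglyMeasurable f μ) (hB : MemLp B p μ) (hFB : ∀ k x, |F k x| ≤ B x)
    (hlim : ∀ x, Tendsto (fun k => F k x) atTop (𝓝 (f x)))
    (hFp : ∀ k, IsPolynomialLimit μ p (F k)) :
    IsPolynomialLimit μ p f := by
  refine .of_forall_near hp hf fun ε hε => ?_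
  have h := tendsto_eLpNorm_sub_of_dominated (zero_lt_one.trans_le hp).ne' hpt hF hf hB hFB hlim
  obtain ⟨k, hk⟩ := (h.eventually_le_const (pos_iff_ne_zero.2 hε)).exists
  exact ⟨F k, hF k, hFp k, hk⟩

/-- The bounded continuous functions whose multiplication operator preserves the property that
all polynomial multiples of a bounded continuous function are `L^p`-limits of polynomials. -/
def polynomialMultipliers (μ : Measure (ι → ℝ)) (hp : 1 ≤ p) : Subalgebra ℝ C(ι → ℝ, ℝ) where
  carrier := {a | (∃ C, ∀ x, |a x| ≤ C) ∧ ∀ g : C(ι → ℝ, ℝ), (∃ C, ∀ x, |g x| ≤ C) →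
    (∀ P, IsPolynomialLimit μ p (fun x => MvPolynomial.eval x P * g x)) →
    ∀ P, IsPolynomialLimit μ p (fun x => MvPolynomial.eval x P * (g x * a x))}
  mul_mem' := by
    rintro a b ⟨⟨C, hC⟩, ha⟩ ⟨⟨D, hD⟩, hb⟩
    have hbdd : ∀ {u v : (ι → ℝ) → ℝ} {C D : ℝ}, (∀ x, |u x| ≤ C) → (∀ x, |v x| ≤ D) →
        ∃ E, ∀ x, |u x * v x| ≤ E := fun {u v C D} hu hv => ⟨C * D, fun x => by
      rw [abs_mul]
      exact mul_le_mul (hu x) (hv x) (abs_nonneg _) ((abs_nonneg _).trans (hu x))⟩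
    refine ⟨hbdd hC hD, fun g ⟨K, hK⟩ hg P => ?_⟩
    simpa [mul_assoc] using hb (g * a) (hbdd hK hC) (ha g ⟨K, hK⟩ hg) P
  add_mem' := by
    rintro a b ⟨⟨C, hC⟩, ha⟩ ⟨⟨D, hD⟩, hb⟩
    refine ⟨⟨C + D, fun x => (abs_add_le _ _).trans (add_le_add (hC x) (hD x))⟩,
      fun g hgb hg P => ?_⟩
    have hm : ∀ c : C(ι → ℝ, ℝ), AEStronglyMeasurable
        (fun x => MvPolynomial.eval x P * (g x * c x)) μ := fun c =>
      ((MvPolynomial.continuous_eval P).mul (g.continuous.mul c.continuous)).aestronglyMeasurable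
    simpa [mul_add] using (ha g hgb hg P).add hp (hm a) (hm b) (hb g hgb hg P)
  algebraMap_mem' := by
    intro r
    refine ⟨⟨|r|, fun x => by simp⟩, fun g _ hg P => ?_⟩
    convert hg (P * MvPolynomial.C r) using 2 with x
    rw [map_mul, MvPolynomial.eval_C, algebraMap_apply, smul_eq_mul]
    ring

lemma isPolynomialLimit_of_mem_polynomialMultipliers (hp : 1 ≤ p) {a : C(ι → ℝ, ℝ)}
    (ha : a ∈ polynomialMultipliers μ hp) : IsPolynomialLimit μ p a := by
  have := ha.2 1 ⟨1, by simp⟩ (fun P => by simpa using isPolynomialLimit_eval μ p P) 1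
  simpa using this

lemma mem_polynomialMultipliers_sin (hp : 1 ≤ p) (hpt : p ≠ ∞) {s : ℝ} (hs : 0 ≤ s) (j : ι)
    (hdom : ∀ P : MvPolynomial ι ℝ,
      MemLp (fun x => MvPolynomial.eval x P * Real.exp (s * |x j|)) p μ) :
    (⟨fun x => Real.sin (s * x j), by fun_prop⟩ : C(ι → ℝ, ℝ)) ∈ polynomialMultipliers μ hp := by
  refine ⟨⟨1, fun x => Real.abs_sin_le_one _⟩, fun g ⟨C, hC⟩ hg P => ?_⟩
  choose T hT using exists_mvPolynomial_eval_eq_sin_partialSum s j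
  have hmT : ∀ N, Continuous fun x => MvPolynomial.eval x (P * T N) * g x := fun N =>
    (MvPolynomial.continuous_eval _).mul g.continuous
  refine IsPolynomialLimit.of_dominated hp hpt
    (F := fun N x => MvPolynomial.eval x (P * T N) * g x)
    (B := fun x => C * ‖MvPolynomial.eval x P * Real.exp (s * |x j|)‖)
    (fun N => (hmT N).aestronglyMeasurable) ?_ ((hdom P).norm.const_mul C) ?_ ?_
    (fun N => hg (P * T N))
  · refine Continuous.aestronglyMeasurable ?_
    exact (MvPolynomial.continuous_eval P).mul (g.continuous.mul (ContinuousMap.continuous _))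
  · intro N x
    have h1 := abs_sin_partialSum_le_exp_abs (s * x j) N
    rw [← hT, abs_mul, abs_of_nonneg hs] at h1
    rw [map_mul, abs_mul, abs_mul, norm_mul, Real.norm_eq_abs, Real.norm_eq_abs, Real.abs_exp,
      mul_comm C]
    exact mul_le_mul (mul_le_mul_of_nonneg_left h1 (abs_nonneg _)) (hC x) (abs_nonneg _)
      (by positivity)
  · intro x
    have h1 : Tendsto (fun N => MvPolynomial.eval x (T N)) atTop (𝓝 (Real.sin (s * x j))) := by
      simp_rw [hT]
      exact (Real.hasSum_sin (s * x j)).tendsto_sum_nat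
    have h2 := (h1.const_mul (MvPolynomial.eval x P)).mul_const (g x)
    simpa [mul_assoc, mul_comm (g x)] using h2

lemma isPolynomialLimit_of_bounded_continuous [IsFiniteMeasure μ] (hp : 1 ≤ p) (hpt : p ≠ ∞)
    (hsep : (polynomialMultipliers μ hp).SeparatesPoints) (f : C(ι → ℝ, ℝ)) {M : ℝ}
    (hM : ∀ x, |f x| ≤ M) : IsPolynomialLimit μ p f := by
  have hM0 : 0 ≤ M := (abs_nonneg _).trans (hM 0)
  have hδ : ∀ k : ℕ, (0 : ℝ) < 1 / ((k : ℝ) + 1) := fun k => by positivity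
  choose h hmem hnear hbd using fun k : ℕ =>
    exists_mem_subalgebra_near_of_isCompact_of_bounded hsep (fun a ha => ha.1) f hM hM0
      (isCompact_closedBall (0 : ι → ℝ) k) (hδ k)
  refine IsPolynomialLimit.of_dominated hp hpt (F := fun k => h k) (B := fun _ => M + 1)
    (fun k => (h k).continuous.aestronglyMeasurable) f.continuous.aestronglyMeasurable
    (memLp_const _) (fun k x => (hbd k x).trans ?_) (fun x => ?_)
    (fun k => isPolynomialLimit_of_mem_polynomialMultipliers hp (hmem k))
  · gcongr
    rw [div_le_one (by positivity)]
    linarith [(Nat.cast_nonneg k : (0 : ℝ) ≤ k)]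
  · rw [tendsto_iff_dist_tendsto_zero]
    refine squeeze_zero' (Eventually.of_forall fun _ => dist_nonneg) ?_
      (mul_zero (2 : ℝ) ▸ tendsto_one_div_add_atTop_nhds_zero_nat.const_mul 2)
    filter_upwards [eventually_ge_atTop ⌈‖x‖⌉₊] with k hk
    rw [Real.dist_eq]
    exact hnear k x (by simpa using (Nat.le_ceil ‖x‖).trans (Nat.cast_le.2 hk))

section ExponentialMoment

variable {α : ℝ}

lemma memLp_exp_mul_abs_coord {j : ι} (h : Integrable (fun x => Real.exp (α * |x j|)) μ)
    {q : ℝ≥0∞} (hq : q ≠ ∞) {s : ℝ} (hs : q.toReal * s ≤ α) :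
    MemLp (fun x : ι → ℝ => Real.exp (s * |x j|)) q μ := by
  have hm : AEStronglyMeasurable (fun x : ι → ℝ => Real.exp (s * |x j|)) μ :=
    Continuous.aestronglyMeasurable (by fun_prop)
  rcases eq_or_ne q 0 with rfl | hq0
  · exact memLp_zero_iff_aestronglyMeasurable.2 hm
  rw [← integrable_norm_rpow_iff hm hq0 hq]
  refine h.mono' (Continuous.aestronglyMeasurable ?_) (Eventually.of_forall fun x => ?_)
  · exact Continuous.rpow_const (by fun_prop) fun x => Or.inr ENNReal.toReal_nonneg
  · rw [Real.norm_eq_abs, Real.norm_eq_abs, Real.abs_exp, ← Real.exp_mul, Real.abs_exp]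
    refine Real.exp_le_exp.2 ?_
    nlinarith [mul_le_mul_of_nonneg_right hs (abs_nonneg (x j))]

lemma memLp_eval_mvPolynomial [IsFiniteMeasure μ] (hα : 0 < α)
    (h : ∀ j, Integrable (fun x => Real.exp (α * |x j|)) μ) (P : MvPolynomial ι ℝ)
    {q : ℝ≥0∞} (hq : q ≠ ∞) : MemLp (fun x => MvPolynomial.eval x P) q μ := by
  induction P using MvPolynomial.induction_on generalizing q with
  | C a => simpa using memLp_const a
  | add P Q hP hQ => simpa [Pi.add_def] using (hP hq).add (hQ hq)
  | mul_X P j hP =>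
    have : ENNReal.HolderTriple (2 * q) (2 * q) q := holderTriple_two_mul q
    have h2q : 2 * q ≠ ∞ := ENNReal.mul_ne_top (by simp) hq
    have hX : MemLp (fun x : ι → ℝ => x j) (2 * q) μ := by
      set s := α / ((2 * q).toReal + 1) with hs
      have hd : 0 < (2 * q).toReal + 1 := by positivity
      have hs0 : 0 < s := by positivity
      have hsα : (2 * q).toReal * s ≤ α := by
        have : ((2 * q).toReal + 1) * s = α := by rw [hs]; field_simp
        nlinarith
      refine ((memLp_exp_mul_abs_coord (h j) h2q hsα).const_mul s⁻¹).mono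
        (Continuous.aestronglyMeasurable (by fun_prop)) (Eventually.of_forall fun x => ?_)
      rw [norm_mul, Real.norm_eq_abs, Real.norm_eq_abs, Real.norm_eq_abs, Real.abs_exp,
        abs_of_pos (inv_pos.2 hs0), inv_mul_eq_div, le_div_iff₀ hs0, mul_comm]
      linarith [Real.add_one_le_exp (s * |x j|)]
    simpa using hX.mul' (hP h2q)

/-- Polynomials are dense in `L^p` of a finite measure on `ℝ^ι` whose coordinates have an
exponential moment. -/
theorem isPolynomialLimit_of_memLp [IsFiniteMeasure μ] (hα : 0 < α)
    (h : ∀ j, Integrable (fun x => Real.exp (α * |x j|)) μ) (hp : 1 ≤ p) (hpt : p ≠ ∞)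
    {f : (ι → ℝ) → ℝ} (hf : MemLp f p μ) : IsPolynomialLimit μ p f := by
  have h2p : 2 * p ≠ ∞ := ENNReal.mul_ne_top (by simp) hpt
  have h2p0 : 0 < (2 * p).toReal :=
    ENNReal.toReal_pos (mul_ne_zero (by simp) (zero_lt_one.trans_le hp).ne') h2p
  have : ENNReal.HolderTriple (2 * p) (2 * p) p := holderTriple_two_mul p
  have hsep : (polynomialMultipliers μ hp).SeparatesPoints := by
    refine separatesPoints_of_sin_mem (div_pos hα h2p0) fun s hs hs' j =>
      mem_polynomialMultipliers_sin hp hpt hs.le j fun P => ?_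
    rw [le_div_iff₀ h2p0, mul_comm] at hs'
    exact (memLp_exp_mul_abs_coord (h j) h2p hs').mul' (memLp_eval_mvPolynomial hα h P h2p)
  refine .of_forall_near hp hf.aestronglyMeasurable fun ε hε => ?_
  obtain ⟨g, hg, hgm⟩ := hf.exists_boundedContinuous_eLpNorm_sub_le hpt hε
  exact ⟨g, hgm.aestronglyMeasurable, isPolynomialLimit_of_bounded_continuous hp hpt hsep
    g.toContinuousMap g.norm_coe_le_norm, hg⟩

end ExponentialMoment

end PolynomialDensity

/-- Dobrushin–Minlos, part (b): under the exponential integrability assumption, polynomials in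
`X_1, …, X_n` are dense in `L^p(Ω, σ(X_1, …, X_n), ℙ)` for every `p ∈ [1, ∞)`. -/
theorem dobrushin_minlos_b
    {Ω : Type*} [MeasurableSpace Ω] (ℙ : Measure Ω) [IsProbabilityMeasure ℙ]
    (n : ℕ) (α : ℝ) (hα : 0 < α) (X : Fin n → Ω → ℝ)
    (hXmeas : ∀ j, Measurable (X j))
    (hXexp : ∀ j, Integrable (fun ω => Real.exp (α * |X j ω|)) ℙ)
    (p : ℝ) (hp : 1 ≤ p) (Y : Ω → ℝ)
    (hY : Measurable[MeasurableSpace.comap (fun ω j => X j ω)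
        (inferInstance : MeasurableSpace (Fin n → ℝ))] Y)
    (hYp : ∫⁻ ω, ENNReal.ofReal (|Y ω| ^ p) ∂ℙ < ⊤)
    (ε : ℝ) (hε : 0 < ε) :
    ∃ P : MvPolynomial (Fin n) ℝ,
      ∫⁻ ω, ENNReal.ofReal (|Y ω - MvPolynomial.eval (fun j => X j ω) P| ^ p) ∂ℙ
        < ENNReal.ofReal (ε ^ p) := by
  have hp0 : 0 < p := zero_lt_one.trans_le hp
  have hq0 : ENNReal.ofReal p ≠ 0 := by simpa using hp0
  have hq1 : 1 ≤ ENNReal.ofReal p := by simpa using hp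
  have hXm : Measurable fun ω j => X j ω := measurable_pi_lambda _ hXmeas
  obtain ⟨f, hf, rfl⟩ := hY.exists_eq_measurable_comp
  set μ := ℙ.map fun ω j => X j ω
  have : IsProbabilityMeasure μ := Measure.isProbabilityMeasure_map hXm.aemeasurable
  have hexp : ∀ j, Integrable (fun x => Real.exp (α * |x j|)) μ := fun j =>
    (integrable_map_measure (Continuous.aestronglyMeasurable (by fun_prop))
      hXm.aemeasurable).2 (hXexp j)
  have henorm : ∀ y : ℝ, ‖y‖ₑ ^ p = ENNReal.ofReal (|y| ^ p) := fun y => by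
    rw [Real.enorm_eq_ofReal_abs, ENNReal.ofReal_rpow_of_nonneg (abs_nonneg y) hp0.le]
  have hfLp : MemLp f (ENNReal.ofReal p) μ := by
    refine (memLp_map_measure_iff hf.aestronglyMeasurable hXm.aemeasurable).2
      ⟨(hf.comp hXm).aestronglyMeasurable, ?_⟩
    rw [eLpNorm_lt_top_iff_lintegral_rpow_enorm_lt_top hq0 ENNReal.ofReal_ne_top,
      ENNReal.toReal_ofReal hp0.le]
    simpa only [henorm] using hYp
  obtain ⟨P, hP⟩ := isPolynomialLimit_of_memLp hα hexp hq1 ENNReal.ofReal_ne_top hfLp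
    (ENNReal.ofReal (ε / 2)) (by simpa using hε)
  refine ⟨P, ?_⟩
  have hm : AEStronglyMeasurable (fun x => f x - MvPolynomial.eval x P) μ :=
    hfLp.aestronglyMeasurable.sub (aestronglyMeasurable_eval_mvPolynomial P)
  rw [eLpNorm_map_measure hm hXm.aemeasurable,
    eLpNorm_eq_lintegral_rpow_enorm_toReal hq0 ENNReal.ofReal_ne_top,
    ENNReal.toReal_ofReal hp0.le, one_div, ENNReal.rpow_inv_le_iff hp0] at hP
  simp only [henorm, Function.comp_apply] at hP ⊢
  refine hP.trans_lt ?_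
  rw [← ENNReal.ofReal_rpow_of_nonneg hε.le hp0.le]
  exact ENNReal.rpow_lt_rpow ((ENNReal.ofReal_lt_ofReal_iff hε).2 (half_lt_self hε)) hp0
end

section
/- Let (Ω, 𝓕, ℙ) be a probability space with a discrete-time filtration (𝓕_t)_{t=0}^T such that 𝓕_0 = {∅, Ω} and 𝓕_T = 𝓕, and let (Z_t)_{t=0}^T be an adapted integrable real-valued process. Then the Snell envelope (U_t) of (Z_t) satisfies U_t = E[Z_{τ_t} | 𝓕_t] almost surely for every t = 0, …, T, where (τ_t) are the recursively defined stopping times. -/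
open MeasureTheory

/-- Replacing `W` by the `m`-measurable `Z` on the event where `Z` is at least the conditional
expectation of `W` turns that conditional expectation into its maximum with `Z`. -/
theorem condExp_ite_condExp_le_ae_eq_max {Ω : Type*} {m m0 : MeasurableSpace Ω} {μ : Measure Ω}
    [IsFiniteMeasure μ] (hm : m ≤ m0) {Z W : Ω → ℝ} (hZm : StronglyMeasurable[m] Z)
    (hZ : Integrable Z μ) (hW : Integrable W μ) :
    Integrable (fun ω => if (μ[W | m]) ω ≤ Z ω then Z ω else W ω) μ ∧
      μ[fun ω => if (μ[W | m]) ω ≤ Z ω then Z ω else W ω | m]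
        =ᵐ[μ] fun ω => max (Z ω) ((μ[W | m]) ω) := by
  set s : Set Ω := {ω | (μ[W | m]) ω ≤ Z ω} with hs
  have hsm : MeasurableSet[m] s :=
    stronglyMeasurable_condExp.measurableSet_le hZm
  have h_eq : (fun ω => if (μ[W | m]) ω ≤ Z ω then Z ω else W ω)
      = s.indicator Z + sᶜ.indicator W := by
    ext ω
    by_cases h : (μ[W | m]) ω ≤ Z ω <;> simp [hs, Set.indicator, h]
  have hZs : Integrable (s.indicator Z) μ := hZ.indicator (hm _ hsm)
  have hWs : Integrable (sᶜ.indicator W) μ := hW.indicator (hm _ hsm.compl)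
  rw [h_eq]
  refine ⟨hZs.add hWs, ?_⟩
  filter_upwards [condExp_add hZs hWs m, condExp_indicator (m := m) hW hsm.compl] with ω h_add h_ind
  rw [h_add, Pi.add_apply, h_ind,
    condExp_of_stronglyMeasurable hm (hZm.indicator hsm) hZs]
  by_cases h : (μ[W | m]) ω ≤ Z ω
  · simp [hs, Set.indicator, h]
  · simp [hs, Set.indicator, h, (not_le.mp h).le]

/-- For an adapted integrable process `(Z_t)_{t=0}^T`, the Snell envelope `(U_t)` satisfies
`U_t = E[Z_{τ_t} | 𝓕_t]` a.s. for every `t = 0, …, T`, where `(τ_t)` are the recursively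
defined stopping times. -/
theorem snell_envelope_eq_condexp_stopped
    {Ω : Type*} [m0 : MeasurableSpace Ω] (ℙ : Measure Ω) [IsProbabilityMeasure ℙ]
    (T : ℕ) (𝓕 : ℕ → MeasurableSpace Ω)
    (h𝓕mono : ∀ s t, s ≤ t → 𝓕 s ≤ 𝓕 t) (h𝓕le : ∀ t, 𝓕 t ≤ m0)
    (h𝓕0 : 𝓕 0 = ⊥) (h𝓕T : 𝓕 T = m0)
    (Z : ℕ → Ω → ℝ)
    (hZadapted : ∀ t ≤ T, StronglyMeasurable[𝓕 t] (Z t))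
    (hZint : ∀ t ≤ T, Integrable (Z t) ℙ)
    (U : ℕ → Ω → ℝ)
    (hUT : U T = Z T)
    (hU : ∀ t < T, U t = fun ω => max (Z t ω) ((ℙ[U (t + 1) | 𝓕 t]) ω))
    (τ : ℕ → Ω → ℕ)
    (hτT : τ T = fun _ => T)
    (hτ : ∀ t < T, τ t = fun ω =>
      if (ℙ[fun ω' => Z (τ (t + 1) ω') ω' | 𝓕 t]) ω ≤ Z t ω then t else τ (t + 1) ω) :
    ∀ t ≤ T, U t =ᵐ[ℙ] ℙ[fun ω => Z (τ t ω) ω | 𝓕 t] := by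
  suffices h : ∀ t ≤ T, Integrable (fun ω => Z (τ t ω) ω) ℙ ∧
      U t =ᵐ[ℙ] ℙ[fun ω => Z (τ t ω) ω | 𝓕 t] from fun t ht => (h t ht).2
  intro t ht
  induction ht using Nat.decreasingInduction with
  | self =>
    simp only [hτT, hUT]
    refine ⟨hZint T le_rfl, ?_⟩
    rw [condExp_of_stronglyMeasurable (h𝓕le T) (hZadapted T le_rfl) (hZint T le_rfl)]
  | of_succ t ht ih =>
    obtain ⟨h_int, h_eq⟩ := ih
    have h_stop : (fun ω => Z (τ t ω) ω) = fun ω =>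
        if (ℙ[fun ω' => Z (τ (t + 1) ω') ω' | 𝓕 t]) ω ≤ Z t ω then Z t ω
        else Z (τ (t + 1) ω) ω := by
      ext ω
      rw [hτ t ht]
      dsimp only
      split_ifs <;> rfl
    have h_max := condExp_ite_condExp_le_ae_eq_max (h𝓕le t) (hZadapted t ht.le)
      (hZint t ht.le) h_int
    rw [h_stop]
    refine ⟨h_max.1, ?_⟩
    have h_tower : ℙ[U (t + 1) | 𝓕 t] =ᵐ[ℙ] ℙ[fun ω => Z (τ (t + 1) ω) ω | 𝓕 t] :=
      (condExp_congr_ae h_eq).trans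
        (condExp_condExp_of_le (h𝓕mono t (t + 1) t.le_succ) (h𝓕le (t + 1)))
    filter_upwards [h_max.2, h_tower] with ω h_max h_tower
    rw [h_max, hU t ht, ← h_tower]
end

section
/- Let (Ω, 𝓕, ℙ) be a probability space with a discrete-time filtration (𝓕_t)_{t=0}^T such that 𝓕_0 = {∅, Ω} and 𝓕_T = 𝓕, and let (Z_t)_{t=0}^T be an adapted integrable real-valued process. Then the stopping time τ_0 is optimal for (Z_t): E[Z_{τ_0}] = U_0 = sup{E[Z_ν] : ν ∈ 𝒞_0^T}, where 𝒞_0^T denotes the set of all stopping times with values in {0, 1, …, T} and (U_t) is the Snell envelope of (Z_t). -/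
open MeasureTheory

namespace MeasureTheory

/-- Conditional expectation of a function glued along a set measurable for the conditioning
σ-algebra. -/
theorem condExp_piecewise {Ω : Type*} {m m0 : MeasurableSpace Ω} {μ : Measure Ω}
    [IsFiniteMeasure μ] (hm : m ≤ m0) {A : Set Ω} [DecidablePred (· ∈ A)]
    (hA : MeasurableSet[m] A) {f g : Ω → ℝ} (hf : StronglyMeasurable[m] f)
    (hfi : Integrable f μ) (hgi : Integrable g μ) :
    μ[A.piecewise f g | m] =ᵐ[μ] A.piecewise f (μ[g | m]) := by
  have hA' : MeasurableSet A := hm A hA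
  rw [← Set.indicator_add_compl_eq_piecewise, ← Set.indicator_add_compl_eq_piecewise]
  refine (condExp_add (hfi.indicator hA') (hgi.indicator hA'.compl) m).trans ?_
  rw [condExp_of_stronglyMeasurable hm (hf.indicator hA) (hfi.indicator hA')]
  exact (Filter.EventuallyEq.refl _ _).add (condExp_indicator hgi hA.compl)

section Snell

variable {Ω : Type*} [m0 : MeasurableSpace Ω] {μ : Measure Ω}
  {T : ℕ} {𝓕 : ℕ → MeasurableSpace Ω} {Z U : ℕ → Ω → ℝ}

theorem snellEnvelope_integrable (hZint : ∀ t ≤ T, Integrable (Z t) μ) (hUT : U T = Z T)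
    (hU : ∀ t < T, U t = fun ω => max (Z t ω) ((μ[U (t + 1) | 𝓕 t]) ω))
    {t : ℕ} (ht : t ≤ T) : Integrable (U t) μ := by
  rcases ht.eq_or_lt with rfl | h
  · exact hUT ▸ hZint t le_rfl
  · rw [hU t h]
    exact (hZint t ht).sup integrable_condExp

theorem integrable_stopped (hZint : ∀ t ≤ T, Integrable (Z t) μ) {ν : Ω → ℕ}
    (hνT : ∀ ω, ν ω ≤ T) (hν : ∀ t, MeasurableSet {ω | ν ω = t}) :
    Integrable (fun ω => Z (ν ω) ω) μ := by
  have h : (fun ω => Z (ν ω) ω) =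
      fun ω => ∑ t ∈ Finset.range (T + 1), {ω | ν ω = t}.indicator (Z t) ω := by
    ext ω
    simp [Set.indicator_apply, hνT ω]
  rw [h]
  exact integrable_finsetSum _ fun t ht =>
    (hZint t (Nat.lt_succ_iff.mp (Finset.mem_range.mp ht))).indicator (hν t)

/-- The Snell envelope dominates the conditional expected reward of every later stopping time. -/
theorem condExp_stopped_le_snellEnvelope [IsFiniteMeasure μ]
    (h𝓕mono : ∀ s t, s ≤ t → 𝓕 s ≤ 𝓕 t) (h𝓕le : ∀ t, 𝓕 t ≤ m0)
    (hZadapted : ∀ t ≤ T, StronglyMeasurable[𝓕 t] (Z t))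
    (hZint : ∀ t ≤ T, Integrable (Z t) μ) (hUT : U T = Z T)
    (hU : ∀ t < T, U t = fun ω => max (Z t ω) ((μ[U (t + 1) | 𝓕 t]) ω))
    {ν : Ω → ℕ} (hνT : ∀ ω, ν ω ≤ T) (hν : ∀ t, MeasurableSet[𝓕 t] {ω | ν ω = t})
    {t : ℕ} (ht : t ≤ T) :
    Integrable (fun ω => Z (max (ν ω) t) ω) μ ∧
      μ[fun ω => Z (max (ν ω) t) ω | 𝓕 t] ≤ᵐ[μ] U t := by
  induction ht using Nat.decreasingInduction with
  | self =>
    have h : (fun ω => Z (max (ν ω) T) ω) = Z T := by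
      ext ω
      rw [max_eq_right (hνT ω)]
    rw [h, condExp_of_stronglyMeasurable (h𝓕le T) (hZadapted T le_rfl) (hZint T le_rfl), hUT]
    exact ⟨hZint T le_rfl, Filter.EventuallyLE.refl _ _⟩
  | of_succ t ht ih =>
    obtain ⟨hi, hle⟩ := ih
    have hA : MeasurableSet[𝓕 t] {ω | ν ω ≤ t} := by
      have h : {ω | ν ω ≤ t} = ⋃ s ∈ Set.Iic t, {ω | ν ω = s} := by
        ext ω
        simp
      rw [h]
      exact MeasurableSet.biUnion (Set.to_countable _) fun s hs => h𝓕mono s t hs _ (hν s)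
    have hZν : (fun ω => Z (max (ν ω) t) ω) =
        {ω | ν ω ≤ t}.piecewise (Z t) (fun ω => Z (max (ν ω) (t + 1)) ω) := by
      ext ω
      by_cases h : ν ω ≤ t
      · simp [Set.piecewise, h]
      · have h' : t + 1 ≤ ν ω := by omega
        simp [Set.piecewise, h, max_eq_left h', max_eq_left (Nat.le_of_succ_le h')]
    rw [hZν]
    refine ⟨Integrable.piecewise (h𝓕le t _ hA) (hZint t ht.le).integrableOn hi.integrableOn, ?_⟩
    have htower := condExp_condExp_of_le (μ := μ) (f := fun ω => Z (max (ν ω) (t + 1)) ω)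
      (h𝓕mono t (t + 1) t.le_succ) (h𝓕le (t + 1))
    have hmono := condExp_mono (m := 𝓕 t) integrable_condExp
      (snellEnvelope_integrable hZint hUT hU ht) hle
    filter_upwards [condExp_piecewise (h𝓕le t) hA (hZadapted t ht.le) (hZint t ht.le) hi,
      htower, hmono] with ω h1 h2 h3
    rw [h1, hU t ht]
    by_cases h : ν ω ≤ t
    · simp [Set.piecewise, h]
    · simp only [Set.piecewise, Set.mem_ofPred_eq, h, if_false]
      exact le_max_of_le_right (h2 ▸ h3)

variable {τ : ℕ → Ω → ℕ}

theorem snell_tau_isStoppingTime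
    (h𝓕mono : ∀ s t, s ≤ t → 𝓕 s ≤ 𝓕 t)
    (hZadapted : ∀ t ≤ T, StronglyMeasurable[𝓕 t] (Z t))
    (hτT : τ T = fun _ => T)
    (hτ : ∀ t < T, τ t = fun ω =>
      if (μ[fun ω' => Z (τ (t + 1) ω') ω' | 𝓕 t]) ω ≤ Z t ω then t else τ (t + 1) ω)
    {t : ℕ} (ht : t ≤ T) :
    (∀ ω, t ≤ τ t ω ∧ τ t ω ≤ T) ∧ ∀ s, MeasurableSet[𝓕 s] {ω | τ t ω = s} := by
  induction ht using Nat.decreasingInduction with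
  | self => simp [hτT]
  | of_succ t ht ih =>
    obtain ⟨hb, hs⟩ := ih
    rw [hτ t ht]
    refine ⟨fun ω => ?_, fun s => ?_⟩
    · have := hb ω
      dsimp only
      split_ifs <;> omega
    · have hA : MeasurableSet[𝓕 t]
          {ω | (μ[fun ω' => Z (τ (t + 1) ω') ω' | 𝓕 t]) ω ≤ Z t ω} :=
        stronglyMeasurable_condExp.measurableSet_le (hZadapted t ht.le)
      rcases lt_trichotomy s t with h | rfl | h
      · convert @MeasurableSet.empty Ω (𝓕 s) using 1
        ext ω
        have := hb ω
        simp only [Set.mem_ofPred_eq, Set.mem_empty_iff_false, iff_false]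
        split_ifs <;> omega
      · convert hA using 1
        ext ω
        have := hb ω
        simp only [Set.mem_ofPred_eq]
        split_ifs with hc
        · simp [hc]
        · simp only [hc, iff_false]
          omega
      · convert (h𝓕mono t s h.le _ hA).compl.inter (hs s) using 1
        ext ω
        simp only [Set.mem_ofPred_eq, Set.mem_inter_iff, Set.mem_compl_iff]
        split_ifs with hc
        · simp only [hc, not_true, false_and, iff_false]
          omega
        · simp [hc]

theorem condExp_snell_tau_eq_snellEnvelope [IsFiniteMeasure μ]
    (h𝓕mono : ∀ s t, s ≤ t → 𝓕 s ≤ 𝓕 t) (h𝓕le : ∀ t, 𝓕 t ≤ m0)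
    (hZadapted : ∀ t ≤ T, StronglyMeasurable[𝓕 t] (Z t))
    (hZint : ∀ t ≤ T, Integrable (Z t) μ) (hUT : U T = Z T)
    (hU : ∀ t < T, U t = fun ω => max (Z t ω) ((μ[U (t + 1) | 𝓕 t]) ω))
    (hτT : τ T = fun _ => T)
    (hτ : ∀ t < T, τ t = fun ω =>
      if (μ[fun ω' => Z (τ (t + 1) ω') ω' | 𝓕 t]) ω ≤ Z t ω then t else τ (t + 1) ω)
    {t : ℕ} (ht : t ≤ T) :
    μ[fun ω => Z (τ t ω) ω | 𝓕 t] =ᵐ[μ] U t := by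
  induction ht using Nat.decreasingInduction with
  | self =>
    rw [hτT, hUT]
    exact (condExp_of_stronglyMeasurable (h𝓕le T) (hZadapted T le_rfl)
      (hZint T le_rfl)).eventuallyEq
  | of_succ t ht ih =>
    obtain ⟨hb, hs⟩ := snell_tau_isStoppingTime h𝓕mono hZadapted hτT hτ (Nat.succ_le_of_lt ht)
    have hi : Integrable (fun ω => Z (τ (t + 1) ω) ω) μ :=
      integrable_stopped hZint (fun ω => (hb ω).2) fun s => h𝓕le s _ (hs s)
    have hA : MeasurableSet[𝓕 t]
        {ω | (μ[fun ω' => Z (τ (t + 1) ω') ω' | 𝓕 t]) ω ≤ Z t ω} :=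
      stronglyMeasurable_condExp.measurableSet_le (hZadapted t ht.le)
    classical
    have hZτ : (fun ω => Z (τ t ω) ω) =
        {ω | (μ[fun ω' => Z (τ (t + 1) ω') ω' | 𝓕 t]) ω ≤ Z t ω}.piecewise (Z t)
          (fun ω => Z (τ (t + 1) ω) ω) := by
      ext ω
      rw [hτ t ht]
      by_cases h : (μ[fun ω' => Z (τ (t + 1) ω') ω' | 𝓕 t]) ω ≤ Z t ω <;>
        simp [Set.piecewise, h]
    rw [hZτ]
    have htower := condExp_condExp_of_le (μ := μ) (f := fun ω => Z (τ (t + 1) ω) ω)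
      (h𝓕mono t (t + 1) t.le_succ) (h𝓕le (t + 1))
    filter_upwards [condExp_piecewise (h𝓕le t) hA (hZadapted t ht.le) (hZint t ht.le) hi,
      htower, condExp_congr_ae (m := 𝓕 t) ih] with ω h1 h2 h3
    rw [h1, hU t ht]
    dsimp only
    rw [← h3, h2]
    by_cases h : (μ[fun ω' => Z (τ (t + 1) ω') ω' | 𝓕 t]) ω ≤ Z t ω
    · simp [Set.piecewise, h]
    · simp [Set.piecewise, h, (not_le.mp h).le]

end Snell

end MeasureTheory

/-- The stopping time `τ_0` is optimal for the adapted integrable process `(Z_t)_{t=0}^T`: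
`E[Z_{τ_0}] = E[U_0]` (with `U_0` the a.s. constant initial value of the Snell envelope) and
`E[Z_{τ_0}]` is the greatest element of `{E[Z_ν] : ν a stopping time with values in {0,…,T}}`. -/
theorem snell_tau_zero_optimal
    {Ω : Type*} [m0 : MeasurableSpace Ω] (ℙ : Measure Ω) [IsProbabilityMeasure ℙ]
    (T : ℕ) (𝓕 : ℕ → MeasurableSpace Ω)
    (h𝓕mono : ∀ s t, s ≤ t → 𝓕 s ≤ 𝓕 t) (h𝓕le : ∀ t, 𝓕 t ≤ m0)
    (h𝓕0 : 𝓕 0 = ⊥) (h𝓕T : 𝓕 T = m0)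
    (Z : ℕ → Ω → ℝ)
    (hZadapted : ∀ t ≤ T, StronglyMeasurable[𝓕 t] (Z t))
    (hZint : ∀ t ≤ T, Integrable (Z t) ℙ)
    (U : ℕ → Ω → ℝ)
    (hUT : U T = Z T)
    (hU : ∀ t < T, U t = fun ω => max (Z t ω) ((ℙ[U (t + 1) | 𝓕 t]) ω))
    (τ : ℕ → Ω → ℕ)
    (hτT : τ T = fun _ => T)
    (hτ : ∀ t < T, τ t = fun ω =>
      if (ℙ[fun ω' => Z (τ (t + 1) ω') ω' | 𝓕 t]) ω ≤ Z t ω then t else τ (t + 1) ω) :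
    (∫ ω, Z (τ 0 ω) ω ∂ℙ) = (∫ ω, U 0 ω ∂ℙ) ∧
    IsGreatest {r : ℝ | ∃ ν : Ω → ℕ, (∀ ω, ν ω ≤ T) ∧
        (∀ t, MeasurableSet[𝓕 t] {ω | ν ω = t}) ∧ r = ∫ ω, Z (ν ω) ω ∂ℙ}
      (∫ ω, Z (τ 0 ω) ω ∂ℙ) := by
  obtain ⟨hb, hs⟩ := snell_tau_isStoppingTime h𝓕mono hZadapted hτT hτ T.zero_le
  have hopt : (∫ ω, Z (τ 0 ω) ω ∂ℙ) = ∫ ω, U 0 ω ∂ℙ := by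
    rw [← integral_condExp (h𝓕le 0)]
    exact integral_congr_ae (condExp_snell_tau_eq_snellEnvelope h𝓕mono h𝓕le hZadapted hZint hUT
      hU hτT hτ T.zero_le)
  refine ⟨hopt, ⟨τ 0, fun ω => (hb ω).2, hs, rfl⟩, ?_⟩
  rintro _ ⟨ν, hνT, hν, rfl⟩
  have hle := (condExp_stopped_le_snellEnvelope h𝓕mono h𝓕le hZadapted hZint hUT hU hνT hν
    T.zero_le).2
  simp only [Nat.max_zero] at hle
  rw [hopt, ← integral_condExp (h𝓕le 0)]
  exact integral_mono_ae integrable_condExp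
    (snellEnvelope_integrable hZint hUT hU T.zero_le) hle
end

section
/- For every t = 1, …, T−1, every a = (a_1, …, a_{T−1}) and ã = (ã_1, …, ã_{T−1}) in ℝ^{k×(T−1)}, every z ∈ ℝ^T, and every x ∈ ℝ^{d×T}, the following estimate holds: |F_t(a, z, x) − F_t(ã, z, x)| ≤ (Σ_{s=t}^{T} |z_s|) · (Σ_{s=t}^{T−1} 1_{{|z_s − e_s(x)ã_s| ≤ |e_s(x)|·‖ã_s − a_s‖}}), where |e_s(x)| denotes the Euclidean norm of the row vector e_s(x) ∈ ℝ^{1×k} and ‖ã_s − a_s‖ the Euclidean norm in ℝ^{k×1}. -/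
open Matrix
open scoped Classical

/-- A value obtained by stopping the sequence `z` at some time in `[t, T]` is bounded by
the sum of the `|z s|` over that range. -/
theorem abs_stopped_le_sum_abs {T : ℕ} {z G : ℕ → ℝ} {p : ℕ → Prop} (hT : G T = z T)
    {t : ℕ} (htT : t ≤ T)
    (hG : ∀ s, t ≤ s → s < T → G s = if p s then G (s + 1) else z s) :
    |G t| ≤ ∑ s ∈ Finset.Icc t T, |z s| := by
  induction htT using Nat.decreasingInduction with
  | self => simp [hT]
  | of_succ t ht ih =>
    have ih := ih fun s hs => hG s (by omega)
    rw [← Finset.add_sum_Ioc_eq_sum_Icc ht.le, ← Finset.Icc_add_one_left_eq_Ioc,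
      hG t le_rfl ht]
    split_ifs
    · linarith [abs_nonneg (z t)]
    · linarith [abs_nonneg (G (t + 1))]

/-- Two stopping rules applied to the same sequence `z` give values that differ by at most
`∑ |z s|` times the number of times `s` lying in any set `q` that contains all disagreements. -/
theorem abs_stopped_sub_stopped_le {T : ℕ} {z G H : ℕ → ℝ} {p p' q : ℕ → Prop}
    (hGT : G T = z T) (hHT : H T = z T) {t : ℕ} (htT : t ≤ T)
    (hG : ∀ s, t ≤ s → s < T → G s = if p s then G (s + 1) else z s)
    (hH : ∀ s, t ≤ s → s < T → H s = if p' s then H (s + 1) else z s)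
    (hq : ∀ s, ¬(p s ↔ p' s) → q s) :
    |G t - H t| ≤ (∑ s ∈ Finset.Icc t T, |z s|) *
      ∑ s ∈ Finset.Ico t T, if q s then (1 : ℝ) else 0 := by
  induction htT using Nat.decreasingInduction with
  | self => simp [hGT, hHT]
  | of_succ t ht ih =>
    have hG' : ∀ s, t + 1 ≤ s → s < T → G s = if p s then G (s + 1) else z s :=
      fun s hs => hG s (by omega)
    have hH' : ∀ s, t + 1 ≤ s → s < T → H s = if p' s then H (s + 1) else z s :=
      fun s hs => hH s (by omega)
    have ih := ih hG' hH'
    have hGb := abs_stopped_le_sum_abs hGT ht hG'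
    have hHb := abs_stopped_le_sum_abs hHT ht hH'
    rw [← Finset.add_sum_Ioc_eq_sum_Icc ht.le, ← Finset.Icc_add_one_left_eq_Ioc,
      Finset.sum_eq_sum_Ico_succ_bot ht, hG t le_rfl ht, hH t le_rfl ht]
    set S := ∑ s ∈ Finset.Icc (t + 1) T, |z s|
    set N := ∑ s ∈ Finset.Ico (t + 1) T, if q s then (1 : ℝ) else 0
    have hS : 0 ≤ S := Finset.sum_nonneg fun _ _ => abs_nonneg _
    have hN : 0 ≤ N := Finset.sum_nonneg fun _ _ => by split_ifs <;> norm_num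
    have hz := abs_nonneg (z t)
    have hI : (0 : ℝ) ≤ if q t then 1 else 0 := by split_ifs <;> norm_num
    by_cases h : p t ↔ p' t
    · have hrhs : S * N ≤ (|z t| + S) * ((if q t then 1 else 0) + N) := by
        gcongr <;> linarith
      by_cases hp : p t
      · rw [if_pos hp, if_pos (h.1 hp)]
        exact ih.trans hrhs
      · rw [if_neg hp, if_neg (mt h.2 hp), sub_self, abs_zero]
        positivity
    · rw [if_pos (hq t h)]
      have hrhs : |z t| + S ≤ (|z t| + S) * (1 + N) :=
        le_mul_of_one_le_right (by positivity) (by linarith)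
      refine le_trans ?_ hrhs
      by_cases hp : p t
      · have hp' : ¬p' t := fun h' => h ⟨fun _ => h', fun _ => hp⟩
        rw [if_pos hp, if_neg hp']
        linarith [abs_sub (G (t + 1)) (z t)]
      · have hp' : p' t := by tauto
        rw [if_neg hp, if_pos hp']
        linarith [abs_sub (z t) (H (t + 1))]

/-- Cauchy–Schwarz inequality for the dot product of real vectors. -/
theorem abs_dotProduct_le_sqrt_mul_sqrt {ι : Type*} [Fintype ι] (u v : ι → ℝ) :
    |u ⬝ᵥ v| ≤ Real.sqrt (∑ i, u i ^ 2) * Real.sqrt (∑ i, v i ^ 2) := by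
  rw [← Real.sqrt_mul (Finset.sum_nonneg fun _ _ => sq_nonneg _)]
  exact Real.abs_le_sqrt (Finset.sum_mul_sq_le_sq_mul_sq _ u v)

/-- If exactly one of the inequalities `y < u ⬝ᵥ v`, `y < u ⬝ᵥ w` holds, then `y` is within
`‖u‖ * ‖w - v‖` of `u ⬝ᵥ w`. -/
theorem abs_sub_dotProduct_le_of_not_lt_iff_lt {ι : Type*} [Fintype ι] {u v w : ι → ℝ} {y : ℝ}
    (h : ¬(y < u ⬝ᵥ v ↔ y < u ⬝ᵥ w)) :
    |y - u ⬝ᵥ w| ≤ Real.sqrt (∑ i, u i ^ 2) * Real.sqrt (∑ i, (w i - v i) ^ 2) := by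
  have hcs := abs_dotProduct_le_sqrt_mul_sqrt u (w - v)
  rw [dotProduct_sub] at hcs
  refine le_trans ?_ hcs
  grind

/-- The key estimate (higher-dimensional counterpart of Clément–Lamberton–Protter, Lemma 3.1):
`|F_t(a,z,x) − F_t(aT,z,x)| ≤ (Σ_{s=t}^T |z_s|) · Σ_{s=t}^{T−1} 1_{{|z_s − e_s(x)aT_s| ≤ |e_s(x)|·‖aT_s − a_s‖}}`,
with Euclidean norms on `ℝ^k`. -/
theorem F_diff_estimate
    (T d k : ℕ) (hT : 2 ≤ T) (hd : 1 ≤ d) (hk : 1 ≤ k)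
    (e : ℕ → Matrix (Fin d) (Fin T) ℝ → (Fin k → ℝ))
    (F : ℕ → (ℕ → Fin k → ℝ) → (ℕ → ℝ) → Matrix (Fin d) (Fin T) ℝ → ℝ)
    (hFT : ∀ a z x, F T a z x = z T)
    (hFrec : ∀ t, 1 ≤ t → t < T → ∀ a z x,
      F t a z x = if z t < e t x ⬝ᵥ a t then F (t + 1) a z x else z t) :
    ∀ t, 1 ≤ t → t < T → ∀ (a aT : ℕ → Fin k → ℝ) (z : ℕ → ℝ)
      (x : Matrix (Fin d) (Fin T) ℝ),
      |F t a z x - F t aT z x| ≤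
        (∑ s ∈ Finset.Icc t T, |z s|) *
        (∑ s ∈ Finset.Ico t T,
          if |z s - e s x ⬝ᵥ aT s| ≤
              Real.sqrt (∑ i, (e s x i) ^ 2) * Real.sqrt (∑ i, (aT s i - a s i) ^ 2)
          then (1 : ℝ) else 0) := by
  intro t ht htT a aT z x
  exact abs_stopped_sub_stopped_le (G := fun s => F s a z x) (H := fun s => F s aT z x)
    (hFT a z x) (hFT aT z x) htT.le
    (fun s hs hsT => hFrec s (ht.trans hs) hsT a z x)
    (fun s hs hsT => hFrec s (ht.trans hs) hsT aT z x)
    fun _ => abs_sub_dotProduct_le_of_not_lt_iff_lt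
end
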